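/- arXiv:math/0607713 — 2 statements merged into one kernel-verified Lean document; each statement's English description precedes it below -/
import Mathlib

section
/- Let A and B be polynomial vector fields on ℂ^p, β ∈ ℕ^p, and t₁, t₂ ∈ ℂ with |t₁|·m(A) + |t₂|·m(B) < 1. Then the doubly indexed family ((t₂^n·t₁^m)/(n!·m!))·coeff_0((D_B^n ∘ D_A^m)(z^β)), indexed by (n,m) ∈ ℕ², is absolutely summable, where coeff_0 denotes the constant coefficient. -/
open MvPolynomial

noncomputable def vfDeriv {p : ℕ} (A : Fin p → MvPolynomial (Fin p) ℂ)
    (P : MvPolynomial (Fin p) ℂ) : MvPolynomial (Fin p) ℂ :=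
  ∑ i, A i * pderiv i P

noncomputable def vfNorm {p : ℕ} (A : Fin p → MvPolynomial (Fin p) ℂ) : ℝ :=
  ⨆ i, ∑ m ∈ (A i).support, ‖(A i).coeff m‖

open Finset in
/-- The generating series of the binomial coefficients converges absolutely on `x + y < 1`. -/
lemma summable_choose_mul_pow_mul_pow {x y : ℝ} (hx : 0 ≤ x) (hy : 0 ≤ y) (hxy : x + y < 1) :
    Summable fun nm : ℕ × ℕ => ((nm.1 + nm.2).choose nm.1 : ℝ) * (x ^ nm.1 * y ^ nm.2) := by
  refine HasAntidiagonal.sigmaAntidiagonalEquivProd.summable_iff.mp ?_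
  rw [summable_sigma_of_nonneg (fun _ => by simp only [Function.comp_apply]; positivity)]
  refine ⟨fun _ => Summable.of_finite, ?_⟩
  refine (summable_geometric_of_lt_one (add_nonneg hx hy) hxy).congr fun n => ?_
  rw [(Commute.all x y).add_pow', tsum_fintype, ← sum_coe_sort]
  refine sum_congr rfl fun c _ => ?_
  simp [mem_antidiagonal.mp c.2]

lemma vfNorm_nonneg {p : ℕ} (A : Fin p → MvPolynomial (Fin p) ℂ) : 0 ≤ vfNorm A :=
  Real.iSup_nonneg fun _ => Finset.sum_nonneg fun _ _ => norm_nonneg _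

lemma sum_norm_coeff_le_vfNorm {p : ℕ} (A : Fin p → MvPolynomial (Fin p) ℂ) (i : Fin p) :
    ∑ m ∈ (A i).support, ‖(A i).coeff m‖ ≤ vfNorm A :=
  le_ciSup (f := fun i => ∑ m ∈ (A i).support, ‖(A i).coeff m‖) (Set.finite_range _).bddAbove i

/-- The derivation `vfDeriv A` as a linear map. -/
noncomputable def vfDerivLinear {p : ℕ} (A : Fin p → MvPolynomial (Fin p) ℂ) :
    MvPolynomial (Fin p) ℂ →ₗ[ℂ] MvPolynomial (Fin p) ℂ where
  toFun := vfDeriv A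
  map_add' P Q := by simp [vfDeriv, mul_add, Finset.sum_add_distrib]
  map_smul' c P := by simp [vfDeriv, Finset.smul_sum]

lemma vfDeriv_monomial {p : ℕ} (A : Fin p → MvPolynomial (Fin p) ℂ) (k : Fin p →₀ ℕ) :
    vfDeriv A (monomial k 1) = ∑ i, ∑ m ∈ (A i).support,
      ((A i).coeff m * (k i : ℂ)) • monomial (m + (k - Finsupp.single i 1)) (1 : ℂ) := by
  refine Finset.sum_congr rfl fun i _ => ?_
  conv_lhs => rw [(A i).as_sum]
  rw [Finset.sum_mul]
  refine Finset.sum_congr rfl fun m _ => ?_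
  simp [pderiv_monomial, monomial_mul, smul_monomial]

/-- A linear functional that is bounded by `C` on monomials and vanishes on monomials of degree
greater than `N`. -/
def BoundedOnMonomials {p : ℕ} (L : MvPolynomial (Fin p) ℂ →ₗ[ℂ] ℂ) (N : ℕ) (C : ℝ) : Prop :=
  ∀ k : Fin p →₀ ℕ, ‖L (monomial k 1)‖ ≤ C ∧ (N < k.degree → L (monomial k 1) = 0)

lemma BoundedOnMonomials.comp_vfDerivLinear {p : ℕ} {L : MvPolynomial (Fin p) ℂ →ₗ[ℂ] ℂ} {N : ℕ}
    {C : ℝ} (hL : BoundedOnMonomials L N C) (A : Fin p → MvPolynomial (Fin p) ℂ) :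
    BoundedOnMonomials (L ∘ₗ vfDerivLinear A) (N + 1) ((N + 1 : ℕ) * (vfNorm A * C)) := by
  have hC : 0 ≤ C := (norm_nonneg _).trans (hL 0).1
  have hA := vfNorm_nonneg A
  intro k
  have key : (L ∘ₗ vfDerivLinear A) (monomial k 1) = ∑ i, ∑ m ∈ (A i).support,
      ((A i).coeff m * (k i : ℂ)) * L (monomial (m + (k - Finsupp.single i 1)) 1) := by
    change L (vfDeriv A (monomial k 1)) = _
    simp [vfDeriv_monomial]
  have hzero : N + 1 < k.degree → (L ∘ₗ vfDerivLinear A) (monomial k 1) = 0 := by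
    intro hk
    rw [key]
    refine Finset.sum_eq_zero fun i _ => Finset.sum_eq_zero fun m _ => ?_
    rcases Nat.eq_zero_or_pos (k i) with hi | hi
    · simp [hi]
    · have hle : Finsupp.single i 1 ≤ k := by simpa [Nat.one_le_iff_ne_zero] using hi.ne'
      have hdeg := congrArg Finsupp.degree (tsub_add_cancel_of_le hle)
      rw [map_add, Finsupp.degree_single] at hdeg
      rw [(hL _).2 (by rw [map_add]; omega), mul_zero]
  refine ⟨?_, hzero⟩
  rcases lt_or_ge (N + 1) k.degree with hk | hk
  · rw [hzero hk, norm_zero]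
    positivity
  · calc ‖(L ∘ₗ vfDerivLinear A) (monomial k 1)‖
        ≤ ∑ i, ∑ m ∈ (A i).support, ‖(A i).coeff m‖ * (k i * C) := by
          rw [key]
          refine norm_sum_le_of_le _ fun i _ => norm_sum_le_of_le _ fun m _ => ?_
          rw [norm_mul, norm_mul, Complex.norm_natCast, mul_assoc]
          gcongr
          exact (hL _).1
      _ ≤ ∑ i, vfNorm A * (k i * C) := by
          refine Finset.sum_le_sum fun i _ => ?_
          rw [← Finset.sum_mul]
          gcongr
          exact sum_norm_coeff_le_vfNorm A i
      _ = k.degree * (vfNorm A * C) := by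
          rw [Finsupp.degree_eq_sum, Nat.cast_sum, Finset.sum_mul]
          exact Finset.sum_congr rfl fun i _ => by ring
      _ ≤ (N + 1 : ℕ) * (vfNorm A * C) := by gcongr

lemma BoundedOnMonomials.comp_vfDerivLinear_pow {p : ℕ} {L : MvPolynomial (Fin p) ℂ →ₗ[ℂ] ℂ}
    {N : ℕ} {C : ℝ} (hL : BoundedOnMonomials L N (N.factorial * C))
    (A : Fin p → MvPolynomial (Fin p) ℂ) (n : ℕ) :
    BoundedOnMonomials (L ∘ₗ vfDerivLinear A ^ n) (N + n)
      ((N + n).factorial * (vfNorm A ^ n * C)) := by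
  induction n with
  | zero => simpa [Module.End.one_eq_id] using hL
  | succ n ih =>
    convert ih.comp_vfDerivLinear A using 1
    · rw [pow_succ, Module.End.mul_eq_comp, LinearMap.comp_assoc]
    · rfl
    · rw [← add_assoc, Nat.factorial_succ]
      push_cast
      ring

lemma boundedOnMonomials_lcoeff_zero {p : ℕ} :
    BoundedOnMonomials (lcoeff ℂ (0 : Fin p →₀ ℕ)) 0 1 := by
  intro k
  rcases eq_or_ne k 0 with rfl | hk
  · simp
  · simp [lcoeff_apply, coeff_monomial, hk]

lemma norm_coeff_zero_vfDeriv_iterate_le {p : ℕ} (A B : Fin p → MvPolynomial (Fin p) ℂ)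
    (β : Fin p →₀ ℕ) (n m : ℕ) :
    ‖coeff 0 ((vfDeriv B)^[n] ((vfDeriv A)^[m] (monomial β 1)))‖ ≤
      (n + m).factorial * (vfNorm B ^ n * vfNorm A ^ m) := by
  have h₀ : BoundedOnMonomials (lcoeff ℂ (0 : Fin p →₀ ℕ)) 0 ((Nat.factorial 0 : ℝ) * 1) := by
    simpa using boundedOnMonomials_lcoeff_zero
  have h := (((h₀.comp_vfDerivLinear_pow B n).comp_vfDerivLinear_pow A m) β).1
  simp only [LinearMap.comp_apply, Module.End.pow_apply, lcoeff_apply, zero_add, mul_one] at h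
  rw [mul_comm (vfNorm B ^ n)]
  exact h

/-- if `|t₁|·m(A) + |t₂|·m(B) < 1` then the doubly indexed family
`((t₂^n·t₁^m)/(n!·m!))·coeff_0((D_B^n ∘ D_A^m)(z^β))` is absolutely summable. -/
theorem stmt_8 (p : ℕ) (hp : 0 < p) (A B : Fin p → MvPolynomial (Fin p) ℂ)
    (β : Fin p →₀ ℕ) (t₁ t₂ : ℂ)
    (ht : ‖t₁‖ * vfNorm A + ‖t₂‖ * vfNorm B < 1) :
    Summable fun nm : ℕ × ℕ =>
      ‖((t₂ ^ nm.1 * t₁ ^ nm.2) / ((Nat.factorial nm.1 : ℂ) * (Nat.factorial nm.2 : ℂ))) *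
        coeff 0 ((vfDeriv B)^[nm.1] ((vfDeriv A)^[nm.2] (monomial β 1)))‖ := by
  have hs := summable_choose_mul_pow_mul_pow (mul_nonneg (norm_nonneg t₂) (vfNorm_nonneg B))
    (mul_nonneg (norm_nonneg t₁) (vfNorm_nonneg A)) (by rwa [add_comm])
  refine hs.of_nonneg_of_le (fun _ => norm_nonneg _) fun ⟨n, m⟩ => ?_
  have h := norm_coeff_zero_vfDeriv_iterate_le A B β n m
  rw [norm_mul, norm_div, norm_mul, norm_mul, norm_pow, norm_pow, Complex.norm_natCast,
    Complex.norm_natCast]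
  refine (mul_le_mul_of_nonneg_left h (by positivity)).trans_eq ?_
  dsimp only
  rw [Nat.choose_symm_add, Nat.add_choose, Nat.cast_div (Nat.factorial_mul_factorial_dvd_factorial_add n m)
    (by positivity), mul_pow, mul_pow]
  push_cast
  ring
end

section
/- Let A be a polynomial vector field on ℂ^p and S ⊆ ℂ^p a bounded set. Then there exists r > 0 such that for every x ∈ S and every t ∈ ℂ with |t| < r, the series y_{i,x}(t) := Σ_{n≥0} (t^n/n!)·(D_A^n(z_i))(x) (i = 1,…,p) converge absolutely, y_{i,x}(0) = x_i, each function t ↦ y_{i,x}(t) is complex differentiable on {|t| < r}, and (d/dt)y_{i,x}(t) = A^i(y_{1,x}(t), …, y_{p,x}(t)), where (D_A^n(z_i))(x) and A^i(w) denote evaluation of the respective polynomials at the points x and w of ℂ^p. -/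
open MvPolynomial

open Finset in
theorem Derivation.iterate_mul {R B : Type*} [CommSemiring R] [CommSemiring B] [Algebra R B]
    (D : Derivation R B B) (n : ℕ) (P Q : B) :
    D^[n] (P * Q) = ∑ ij ∈ antidiagonal n, n.choose ij.1 • (D^[ij.1] P * D^[ij.2] Q) := by
  induction n with
  | zero => simp
  | succ n ih =>
    rw [Function.iterate_succ_apply', ih, map_sum,
      sum_antidiagonal_choose_succ_nsmul (fun i j => D^[i] P * D^[j] Q) n, ← sum_add_distrib]
    refine sum_congr rfl fun ij hij => ?_
    rw [map_nsmul, D.leibniz, ← Function.iterate_succ_apply' D, ← Function.iterate_succ_apply' D,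
      smul_eq_mul, smul_eq_mul, nsmul_add, mul_comm (D^[ij.2] Q),
      Nat.choose_symm_of_eq_add (mem_antidiagonal.1 hij).symm]

theorem vfDeriv_eq_mkDerivation {p : ℕ} (A : Fin p → MvPolynomial (Fin p) ℂ) :
    vfDeriv A = mkDerivation ℂ A := by
  have hsum : ∀ P, (∑ i, A i • pderiv i : Derivation ℂ _ _) P = ∑ i, (A i • pderiv i) P := by
    intro P
    rw [← Derivation.coeFnAddMonoidHom_apply, map_sum, Finset.sum_apply]
    rfl
  have h : mkDerivation ℂ A = ∑ i, A i • pderiv i := by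
    classical
    refine derivation_ext fun j => ?_
    rw [mkDerivation_X, hsum]
    simp [pderiv_X, Pi.single_apply]
  ext1 P
  rw [h, hsum]
  simp [vfDeriv]

namespace MvPolynomial

variable {σ : Type*}

/-- The sum of the absolute values of the coefficients. -/
noncomputable def coeffNorm (P : MvPolynomial σ ℂ) : ℝ := ∑ m ∈ P.support, ‖P.coeff m‖

theorem coeffNorm_nonneg (P : MvPolynomial σ ℂ) : 0 ≤ P.coeffNorm :=
  Finset.sum_nonneg fun _ _ => norm_nonneg _

theorem coeffNorm_eq_sum_of_subset {P : MvPolynomial σ ℂ} {s : Finset (σ →₀ ℕ)}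
    (h : P.support ⊆ s) : P.coeffNorm = ∑ m ∈ s, ‖P.coeff m‖ :=
  Finset.sum_subset h fun m _ hm => by simpa using hm

@[simp]
theorem coeffNorm_zero : (0 : MvPolynomial σ ℂ).coeffNorm = 0 := by simp [coeffNorm]

theorem coeffNorm_add_le (P Q : MvPolynomial σ ℂ) :
    (P + Q).coeffNorm ≤ P.coeffNorm + Q.coeffNorm := by
  classical
  rw [coeffNorm_eq_sum_of_subset (support_add (p := P) (q := Q)),
    coeffNorm_eq_sum_of_subset (P := P) Finset.subset_union_left,
    coeffNorm_eq_sum_of_subset (P := Q) Finset.subset_union_right, ← Finset.sum_add_distrib]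
  exact Finset.sum_le_sum fun m _ => by simpa using norm_add_le (P.coeff m) (Q.coeff m)

theorem coeffNorm_sum_le {ι : Type*} (s : Finset ι) (f : ι → MvPolynomial σ ℂ) :
    (∑ i ∈ s, f i).coeffNorm ≤ ∑ i ∈ s, (f i).coeffNorm :=
  Finset.le_sum_of_subadditive coeffNorm coeffNorm_zero.le coeffNorm_add_le s f

@[simp]
theorem coeffNorm_monomial (m : σ →₀ ℕ) (a : ℂ) : (monomial m a).coeffNorm = ‖a‖ := by
  classical
  rw [coeffNorm_eq_sum_of_subset support_monomial_subset]
  simp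

theorem coeffNorm_mul_le (P Q : MvPolynomial σ ℂ) :
    (P * Q).coeffNorm ≤ P.coeffNorm * Q.coeffNorm := by
  conv_lhs => rw [P.as_sum, Q.as_sum, Finset.sum_mul_sum]
  rw [coeffNorm.eq_def P, coeffNorm.eq_def Q, Finset.sum_mul_sum]
  refine (coeffNorm_sum_le _ _).trans (Finset.sum_le_sum fun m _ => ?_)
  refine (coeffNorm_sum_le _ _).trans (Finset.sum_le_sum fun n _ => ?_)
  rw [monomial_mul, coeffNorm_monomial, norm_mul]

theorem coeffNorm_pderiv_le (i : σ) (P : MvPolynomial σ ℂ) :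
    (pderiv i P).coeffNorm ≤ P.totalDegree * P.coeffNorm := by
  conv_lhs => rw [P.as_sum, map_sum]
  rw [coeffNorm.eq_def P, Finset.mul_sum]
  refine (coeffNorm_sum_le _ _).trans (Finset.sum_le_sum fun m hm => ?_)
  rw [pderiv_monomial, coeffNorm_monomial, norm_mul, mul_comm, Complex.norm_natCast]
  have : m i ≤ P.totalDegree := (m.le_degree i).trans (le_totalDegree hm)
  gcongr

theorem norm_eval_le [Fintype σ] (P : MvPolynomial σ ℂ) {x : σ → ℂ} {R : ℝ} (hR : 1 ≤ R)
    (hx : ∀ i, ‖x i‖ ≤ R) : ‖eval x P‖ ≤ P.coeffNorm * R ^ P.totalDegree := by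
  rw [eval_eq', coeffNorm, Finset.sum_mul]
  refine norm_sum_le_of_le _ fun m hm => ?_
  rw [norm_mul, norm_prod]
  refine mul_le_mul_of_nonneg_left ?_ (norm_nonneg _)
  calc ∏ i, ‖x i ^ m i‖ ≤ ∏ i, R ^ m i := by
        refine Finset.prod_le_prod (fun _ _ => norm_nonneg _) fun i _ => ?_
        rw [norm_pow]
        exact pow_le_pow_left₀ (norm_nonneg _) (hx i) _
    _ = R ^ m.degree := by rw [Finset.prod_pow_eq_pow_sum, Finsupp.degree_eq_sum]
    _ ≤ R ^ P.totalDegree := pow_le_pow_right₀ hR (le_totalDegree hm)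

theorem totalDegree_pderiv_le (i : σ) (P : MvPolynomial σ ℂ) :
    (pderiv i P).totalDegree ≤ P.totalDegree := by
  conv_lhs => rw [P.as_sum, map_sum]
  refine totalDegree_finsetSum_le fun m hm => ?_
  rw [pderiv_monomial]
  refine (totalDegree_monomial_le _ _).trans ?_
  refine le_trans ?_ (le_totalDegree hm)
  exact Finsupp.degree_mono tsub_le_self

end MvPolynomial

section

variable {p : ℕ} {A : Fin p → MvPolynomial (Fin p) ℂ} {d : ℕ} {M : ℝ}

theorem totalDegree_vfDeriv_le (hd : ∀ i, (A i).totalDegree ≤ d) (P : MvPolynomial (Fin p) ℂ) :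
    (vfDeriv A P).totalDegree ≤ P.totalDegree + d := by
  refine totalDegree_finsetSum_le fun i _ => (totalDegree_mul _ _).trans ?_
  have := hd i
  have := totalDegree_pderiv_le i P
  lia

theorem coeffNorm_vfDeriv_le (hM : ∀ i, (A i).coeffNorm ≤ M) (P : MvPolynomial (Fin p) ℂ) :
    (vfDeriv A P).coeffNorm ≤ p * M * P.totalDegree * P.coeffNorm := by
  refine (coeffNorm_sum_le _ _).trans ?_
  refine (Finset.sum_le_card_nsmul _ _ (M * (P.totalDegree * P.coeffNorm)) fun i _ => ?_).trans ?_
  · refine (coeffNorm_mul_le _ _).trans ?_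
    exact mul_le_mul (hM i) (coeffNorm_pderiv_le i P) (coeffNorm_nonneg _)
      ((coeffNorm_nonneg _).trans (hM i))
  · simp [mul_assoc]

theorem totalDegree_iterate_vfDeriv_le (hd : ∀ i, (A i).totalDegree ≤ d)
    (P : MvPolynomial (Fin p) ℂ) (n : ℕ) :
    ((vfDeriv A)^[n] P).totalDegree ≤ P.totalDegree + n * d := by
  induction n with
  | zero => simp
  | succ n ih =>
    rw [Function.iterate_succ_apply']
    refine (totalDegree_vfDeriv_le hd _).trans ?_
    lia

theorem coeffNorm_iterate_vfDeriv_le (hd : ∀ i, (A i).totalDegree ≤ d)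
    (hM₀ : 0 ≤ M) (hM : ∀ i, (A i).coeffNorm ≤ M) (P : MvPolynomial (Fin p) ℂ) (n : ℕ) :
    ((vfDeriv A)^[n] P).coeffNorm ≤
      n.factorial * (p * M * (P.totalDegree + d)) ^ n * P.coeffNorm := by
  induction n with
  | zero => simp
  | succ n ih =>
    rw [Function.iterate_succ_apply']
    refine (coeffNorm_vfDeriv_le hM _).trans ?_
    have h : (((vfDeriv A)^[n] P).totalDegree : ℝ) ≤ (n + 1) * (P.totalDegree + d) := by
      have h₁ := totalDegree_iterate_vfDeriv_le hd P n
      have h₂ : P.totalDegree + n * d ≤ (n + 1) * (P.totalDegree + d) := by nlinarith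
      exact_mod_cast h₁.trans h₂
    have := coeffNorm_nonneg ((vfDeriv A)^[n] P)
    calc _ ≤ p * M * ((n + 1) * (P.totalDegree + d)) *
          (n.factorial * (p * M * (P.totalDegree + d)) ^ n * P.coeffNorm) := by gcongr
      _ = _ := by rw [Nat.factorial_succ]; push_cast; ring

theorem exists_norm_eval_iterate_vfDeriv_X_le (A : Fin p → MvPolynomial (Fin p) ℂ)
    {S : Set (Fin p → ℂ)} (hS : Bornology.IsBounded S) :
    ∃ K C : ℝ, 0 ≤ K ∧ 0 ≤ C ∧ ∀ x ∈ S, ∀ i n,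
      ‖eval x ((vfDeriv A)^[n] (X i))‖ ≤ n.factorial * (K * C ^ n) := by
  obtain ⟨R, hR, hx⟩ := hS.exists_pos_norm_le
  let d := ∑ i, (A i).totalDegree
  let M := ∑ i, (A i).coeffNorm
  have hd : ∀ i, (A i).totalDegree ≤ d := fun i =>
    Finset.single_le_sum (f := fun i => (A i).totalDegree) (fun _ _ => Nat.zero_le _)
      (Finset.mem_univ i)
  have hM : ∀ i, (A i).coeffNorm ≤ M := fun i =>
    Finset.single_le_sum (f := fun i => (A i).coeffNorm) (fun _ _ => coeffNorm_nonneg _)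
      (Finset.mem_univ i)
  have hM₀ : 0 ≤ M := Finset.sum_nonneg fun _ _ => coeffNorm_nonneg _
  refine ⟨R + 1, p * M * (1 + d) * (R + 1) ^ d, by positivity, by positivity,
    fun x hxS i n => ?_⟩
  have hR₁ : 1 ≤ R + 1 := by linarith
  have hxR : ∀ j, ‖x j‖ ≤ R + 1 := fun j => by
    linarith [norm_le_pi_norm x j, hx x hxS]
  have hN := coeffNorm_iterate_vfDeriv_le hd hM₀ hM (X i) n
  have hX : (X i : MvPolynomial (Fin p) ℂ).coeffNorm = 1 := by simp [X]
  rw [totalDegree_X, hX, Nat.cast_one, mul_one] at hN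
  have hD := totalDegree_iterate_vfDeriv_le hd (X i) n
  rw [totalDegree_X] at hD
  calc _ ≤ _ := norm_eval_le _ hR₁ hxR
    _ ≤ (n.factorial * (p * M * (1 + d)) ^ n) * (R + 1) ^ (1 + n * d) := by gcongr
    _ = _ := by rw [mul_pow _ ((R + 1) ^ d), ← pow_mul]; ring

/-- The `n`-th term of the Lie series `∑ tⁿ / n! • D_Aⁿ P`, evaluated at `x`. -/
noncomputable def lieTerm (A : Fin p → MvPolynomial (Fin p) ℂ) (x : Fin p → ℂ) (t : ℂ)
    (P : MvPolynomial (Fin p) ℂ) (n : ℕ) : ℂ :=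
  t ^ n / (n.factorial : ℂ) * eval x ((vfDeriv A)^[n] P)

theorem lieTerm_add (x : Fin p → ℂ) (t : ℂ) (P Q : MvPolynomial (Fin p) ℂ) (n : ℕ) :
    lieTerm A x t (P + Q) n = lieTerm A x t P n + lieTerm A x t Q n := by
  simp only [lieTerm, vfDeriv_eq_mkDerivation, iterate_map_add, map_add, mul_add]

theorem lieTerm_mul (x : Fin p → ℂ) (t : ℂ) (P Q : MvPolynomial (Fin p) ℂ) (n : ℕ) :
    lieTerm A x t (P * Q) n =
      ∑ ij ∈ Finset.HasAntidiagonal.antidiagonal n, lieTerm A x t P ij.1 * lieTerm A x t Q ij.2 := by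
  simp only [lieTerm, vfDeriv_eq_mkDerivation, Derivation.iterate_mul, map_sum, Finset.mul_sum]
  refine Finset.sum_congr rfl fun ij hij => ?_
  obtain rfl := Finset.HasAntidiagonal.mem_antidiagonal.1 hij
  have h : ((ij.1 + ij.2).choose ij.1 : ℂ) * ij.1.factorial * ij.2.factorial =
      (ij.1 + ij.2).factorial := by
    have h := Nat.choose_mul_factorial_mul_factorial (Nat.le_add_right ij.1 ij.2)
    rw [Nat.add_sub_cancel_left] at h
    exact_mod_cast h
  have h₁ : (ij.1.factorial : ℂ) ≠ 0 := by exact_mod_cast ij.1.factorial_ne_zero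
  have h₂ : (ij.2.factorial : ℂ) ≠ 0 := by exact_mod_cast ij.2.factorial_ne_zero
  have h₃ : ((ij.1 + ij.2).factorial : ℂ) ≠ 0 := by exact_mod_cast Nat.factorial_ne_zero _
  rw [map_nsmul, map_mul, nsmul_eq_mul]
  field_simp
  rw [← h]
  ring

theorem tsum_lieTerm_C (x : Fin p → ℂ) (t a : ℂ) :
    (Summable fun n => ‖lieTerm A x t (C a) n‖) ∧ ∑' n, lieTerm A x t (C a) n = a := by
  have h : ∀ n ≠ 0, lieTerm A x t (C a) n = 0 := by
    intro n hn
    obtain ⟨m, rfl⟩ := Nat.exists_eq_succ_of_ne_zero hn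
    simp only [lieTerm, vfDeriv_eq_mkDerivation, Function.iterate_succ_apply, derivation_C,
      iterate_map_zero, map_zero, mul_zero]
  refine ⟨summable_of_ne_finset_zero (s := {0}) fun n hn => ?_, ?_⟩
  · rw [h n (by simpa using hn), norm_zero]
  · rw [tsum_eq_single 0 h]
    simp [lieTerm]

/-- Where the Lie series of the coordinates converge absolutely, so do those of all polynomials,
and the Lie series is a ring homomorphism. -/
theorem tsum_lieTerm {x : Fin p → ℂ} {t : ℂ}
    (hX : ∀ i, Summable fun n => ‖lieTerm A x t (X i) n‖) (P : MvPolynomial (Fin p) ℂ) :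
    (Summable fun n => ‖lieTerm A x t P n‖) ∧
      ∑' n, lieTerm A x t P n = eval (fun i => ∑' n, lieTerm A x t (X i) n) P := by
  have hmul : ∀ P Q : MvPolynomial (Fin p) ℂ, (Summable fun n => ‖lieTerm A x t P n‖) →
      (Summable fun n => ‖lieTerm A x t Q n‖) →
      (Summable fun n => ‖lieTerm A x t (P * Q) n‖) ∧ ∑' n, lieTerm A x t (P * Q) n =
        (∑' n, lieTerm A x t P n) * ∑' n, lieTerm A x t Q n := by
    intro P Q hP hQ
    simp only [lieTerm_mul]
    exact ⟨summable_norm_sum_mul_antidiagonal_of_summable_norm hP hQ,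
      (tsum_mul_tsum_eq_tsum_sum_antidiagonal_of_summable_norm hP hQ).symm⟩
  induction P using MvPolynomial.induction_on with
  | C a => simpa using tsum_lieTerm_C x t a
  | add P Q hP hQ =>
    simp only [lieTerm_add, map_add]
    refine ⟨(hP.1.add hQ.1).of_nonneg_of_le (fun _ => norm_nonneg _) fun _ => norm_add_le _ _, ?_⟩
    rw [hP.1.of_norm.tsum_add hQ.1.of_norm, hP.2, hQ.2]
  | mul_X P i hP =>
    refine ⟨(hmul P (X i) hP.1 (hX i)).1, ?_⟩
    rw [(hmul P (X i) hP.1 (hX i)).2, hP.2, map_mul, eval_X]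

end

theorem norm_div_factorial_mul_le {c : ℂ} {B : ℝ} {n : ℕ} (hc : ‖c‖ ≤ n.factorial * B) (a : ℂ) :
    ‖a / (n.factorial : ℂ) * c‖ ≤ ‖a‖ * B := by
  have hn : (0 : ℝ) < n.factorial := by exact_mod_cast n.factorial_pos
  rw [norm_mul, norm_div, Complex.norm_natCast]
  calc ‖a‖ / n.factorial * ‖c‖ ≤ ‖a‖ / n.factorial * (n.factorial * B) := by gcongr
    _ = ‖a‖ * B := by rw [← mul_assoc, div_mul_cancel₀ _ hn.ne']

/-- An exponential power series whose coefficients grow at most like `n! K Cⁿ` converges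
absolutely on a disc, and its derivative there is obtained by shifting the coefficients. -/
theorem summable_and_hasDerivAt_of_factorial_bound {c : ℕ → ℂ} {K C r : ℝ} (hC : 0 ≤ C)
    (hK : 0 ≤ K) (hr : 0 < r) (hCr : C * r ≤ 1 / 2)
    (hc : ∀ n, ‖c n‖ ≤ n.factorial * (K * C ^ n)) {t : ℂ} (ht : ‖t‖ < r) :
    (Summable fun n : ℕ => ‖t ^ n / (n.factorial : ℂ) * c n‖) ∧
      HasDerivAt (fun s : ℂ => ∑' n : ℕ, s ^ n / (n.factorial : ℂ) * c n)
        (∑' n : ℕ, t ^ n / (n.factorial : ℂ) * c (n + 1)) t := by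
  have hsum : ∀ s : ℂ, ‖s‖ < r → Summable fun n : ℕ => ‖s ^ n / (n.factorial : ℂ) * c n‖ := by
    intro s hs
    refine ((summable_geometric_two).mul_left K).of_nonneg_of_le (fun _ => norm_nonneg _)
      fun n => ?_
    refine (norm_div_factorial_mul_le (hc n) _).trans ?_
    rw [norm_pow]
    calc ‖s‖ ^ n * (K * C ^ n) ≤ r ^ n * (K * C ^ n) := by gcongr
      _ = K * (C * r) ^ n := by rw [mul_pow]; ring
      _ ≤ K * (1 / 2) ^ n := by gcongr
  refine ⟨hsum t ht, ?_⟩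
  have hhalf : ‖(1 / 2 : ℝ)‖ < 1 := by norm_num
  have hu : Summable fun n : ℕ => K / r * ((n : ℝ) ^ 1 * (1 / 2 : ℝ) ^ n) :=
    (summable_pow_mul_geometric_of_norm_lt_one 1 hhalf).mul_left (K / r)
  have hbound : ∀ (n : ℕ) (s : ℂ), s ∈ Metric.ball (0 : ℂ) r →
      ‖(n * s ^ (n - 1)) / (n.factorial : ℂ) * c n‖ ≤ K / r * ((n : ℝ) ^ 1 * (1 / 2 : ℝ) ^ n) := by
    intro n s hs
    rw [mem_ball_zero_iff] at hs
    rcases n with _ | n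
    · simp
    refine (norm_div_factorial_mul_le (hc (n + 1)) _).trans ?_
    rw [norm_mul, norm_pow, Complex.norm_natCast, Nat.add_sub_cancel, pow_one]
    calc ((n + 1 : ℕ) : ℝ) * ‖s‖ ^ n * (K * C ^ (n + 1))
        ≤ ((n + 1 : ℕ) : ℝ) * r ^ n * (K * C ^ (n + 1)) := by gcongr
      _ = K / r * (((n + 1 : ℕ) : ℝ) * (C * r) ^ (n + 1)) := by
        rw [mul_pow, pow_succ r]
        field_simp
      _ ≤ _ := by gcongr
  have hterm : ∀ (n : ℕ) (s : ℂ), s ∈ Metric.ball (0 : ℂ) r →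
      HasDerivAt (fun s : ℂ => s ^ n / (n.factorial : ℂ) * c n)
        ((n * s ^ (n - 1)) / (n.factorial : ℂ) * c n) s := fun n s _ =>
    ((hasDerivAt_pow n s).div_const (n.factorial : ℂ)).mul_const (c n)
  have hder := hasDerivAt_tsum_of_isPreconnected hu Metric.isOpen_ball
    (convex_ball (0 : ℂ) r).isPreconnected hterm hbound
    (Metric.mem_ball_self hr) (hsum 0 (by simpa using hr)).of_norm (mem_ball_zero_iff.2 ht)
  refine hder.congr_deriv ?_
  rw [(Summable.of_norm_bounded hu fun n =>
    hbound n t (mem_ball_zero_iff.2 ht)).tsum_eq_zero_add]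
  simp only [Nat.cast_zero, zero_mul, zero_div, zero_add, Nat.add_sub_cancel]
  refine tsum_congr fun n => ?_
  have hn : ((n : ℂ) + 1) ≠ 0 := by exact_mod_cast n.succ_ne_zero
  rw [Nat.factorial_succ]
  push_cast
  rw [mul_div_mul_left _ _ hn]

/-- for a bounded set `S ⊆ ℂ^p` there is `r > 0` such that for every
`x ∈ S` and `|t| < r` the series `y_{i,x}(t) := Σ_{n≥0} (t^n/n!)·(D_A^n(z_i))(x)`
converge absolutely, `y_{i,x}(0) = x_i`, each `t ↦ y_{i,x}(t)` is complex
differentiable on `{|t| < r}`, and `y_{i,x}'(t) = A^i(y_{1,x}(t), …, y_{p,x}(t))`. -/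
theorem stmt_16 (p : ℕ) (hp : 0 < p) (A : Fin p → MvPolynomial (Fin p) ℂ)
    (S : Set (Fin p → ℂ)) (hS : Bornology.IsBounded S) :
    ∃ r : ℝ, 0 < r ∧ ∀ x ∈ S,
      let y : Fin p → ℂ → ℂ := fun i s =>
        ∑' n : ℕ, (s ^ n / (Nat.factorial n : ℂ)) * eval x ((vfDeriv A)^[n] (X i))
      (∀ i : Fin p, ∀ t : ℂ, ‖t‖ < r →
        Summable fun n : ℕ =>
          ‖(t ^ n / (Nat.factorial n : ℂ)) * eval x ((vfDeriv A)^[n] (X i))‖) ∧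
      (∀ i : Fin p, y i 0 = x i) ∧
      (∀ i : Fin p, ∀ t : ℂ, ‖t‖ < r →
        HasDerivAt (y i) (eval (fun j => y j t) (A i)) t) := by
  obtain ⟨K, C, hK, hC, hbound⟩ := exists_norm_eval_iterate_vfDeriv_X_le A hS
  have hr : 0 < 1 / (2 * (C + 1)) := by positivity
  have hCr : C * (1 / (2 * (C + 1))) ≤ 1 / 2 := by
    rw [mul_one_div, div_le_div_iff₀ (by positivity) two_pos]
    linarith
  refine ⟨1 / (2 * (C + 1)), hr, fun x hx => ?_⟩
  have key := fun (i : Fin p) (t : ℂ) (ht : ‖t‖ < 1 / (2 * (C + 1))) =>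
    summable_and_hasDerivAt_of_factorial_bound hC hK hr hCr (hbound x hx i) ht
  refine ⟨fun i t ht => (key i t ht).1, fun i => ?_, fun i t ht => ?_⟩
  · dsimp only
    rw [tsum_eq_single 0 fun n hn => by simp [hn]]
    simp
  · convert (key i t ht).2 using 1
    refine (tsum_lieTerm (fun j => (key j t ht).1) (A i)).2.symm.trans ?_
    refine tsum_congr fun n => ?_
    rw [lieTerm, Function.iterate_succ_apply, vfDeriv_eq_mkDerivation, mkDerivation_X]
end
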